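/- Let n ≥ 1, f, x, x* ∈ {0,1}^n, i ∈ [n], and let Δ = {j ∈ [n] : f_j = 1, x_j ≠ x*_j} and A = Δ \ {i}. Then the inner coalition sum for a single background point x satisfies Σ_{S ⊆ [n]\{i}} (|S|! (n−|S|−1)!/n!) · ((−1)^{⟨f, z^{S∪{i}}⟩} − (−1)^{⟨f, z^S⟩}) = −2 · f_i · 1[x_i ≠ x*_i] · (−1)^{⟨f,x⟩} · ((|A|+1) mod 2)/(|A|+1), where z^S denotes the hybrid point with z^S_j = x*_j for j ∈ S and z^S_j = x_j otherwise. -/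

import Mathlib

open Finset

/-- Integer inner product `⟨f,y⟩ = Σ_j f_j y_j` of two points of `{0,1}^n`. -/
def ip {n : ℕ} (f y : Fin n → Fin 2) : ℕ := ∑ j : Fin n, (f j : ℕ) * (y j : ℕ)

/-- Hybrid point: coordinates from `xstar` on `S`, from `x` off `S`. -/
def hybrid {n : ℕ} (xstar x : Fin n → Fin 2) (S : Finset (Fin n)) : Fin n → Fin 2 :=
  fun j => if j ∈ S then xstar j else x j

/-- Shapley kernel weight `|S|!·(n−|S|−1)!/n!`. -/
noncomputable def shapWeight (n : ℕ) (S : Finset (Fin n)) : ℝ :=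
  ((Nat.factorial S.card * Nat.factorial (n - S.card - 1) : ℕ) : ℝ) / (Nat.factorial n : ℝ)

/-- Value function: average prediction over the background dataset `D`
when fixing the coordinates of the explained instance `xstar` on `S`. -/
noncomputable def valueFn {n : ℕ} (h : (Fin n → Fin 2) → ℝ) (D : List (Fin n → Fin 2))
    (xstar : Fin n → Fin 2) (S : Finset (Fin n)) : ℝ :=
  (1 / (D.length : ℝ)) * (D.map (fun x => h (hybrid xstar x S))).sum

/-- SHAP value of feature `i` for predictor `h`, background dataset `D`, instance `xstar`. -/
noncomputable def shapValue {n : ℕ} (h : (Fin n → Fin 2) → ℝ) (D : List (Fin n → Fin 2))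
    (xstar : Fin n → Fin 2) (i : Fin n) : ℝ :=
  ∑ S ∈ (Finset.univ.erase i).powerset,
    shapWeight n S * (valueFn h D xstar (insert i S) - valueFn h D xstar S)

/-- Adding a dummy player does not change the Shapley weights:
the two weights of a coalition with and without the dummy add up to the original weight. -/
lemma factorial_weight_add {m s : ℕ} (hs : s ≤ m) :
    ((s.factorial * (m + 1 - s).factorial : ℕ) : ℝ) / ((m + 2).factorial : ℝ)
      + (((s + 1).factorial * (m + 1 - (s + 1)).factorial : ℕ) : ℝ) / ((m + 2).factorial : ℝ)
      = ((s.factorial * (m - s).factorial : ℕ) : ℝ) / ((m + 1).factorial : ℝ) := by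
  obtain ⟨k, rfl⟩ := Nat.exists_eq_add_of_le hs
  have h1 : s + k + 1 - s = k + 1 := by omega
  have h2 : s + k + 1 - (s + 1) = k := by omega
  have h3 : s + k - s = k := by omega
  rw [h1, h2, h3, Nat.factorial_succ (s + k + 1), Nat.factorial_succ s, Nat.factorial_succ k]
  have h4 : ((s + k + 1).factorial : ℝ) ≠ 0 := by positivity
  have h5 : (s : ℝ) + k + 1 + 1 ≠ 0 := by positivity
  push_cast
  field_simp
  ring

lemma sum_powerset_weight_mul_neg_one_pow {α : Type*} (A : Finset α) :
    ∑ S ∈ A.powerset, ((S.card.factorial * (A.card - S.card).factorial : ℕ) : ℝ)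
        / ((A.card + 1).factorial : ℝ) * (-1 : ℝ) ^ S.card
      = (((A.card + 1) % 2 : ℕ) : ℝ) / ((A.card : ℝ) + 1) := by
  rw [Finset.sum_powerset_apply_card (fun k => ((k.factorial * (A.card - k).factorial : ℕ) : ℝ)
    / ((A.card + 1).factorial : ℝ) * (-1 : ℝ) ^ k)]
  have hterm : ∀ k ∈ Finset.range (A.card + 1),
      A.card.choose k • (((k.factorial * (A.card - k).factorial : ℕ) : ℝ)
        / ((A.card + 1).factorial : ℝ) * (-1 : ℝ) ^ k)
      = (-1 : ℝ) ^ k / ((A.card : ℝ) + 1) := by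
    intro k hk
    have hc := Nat.choose_mul_factorial_mul_factorial (Nat.lt_succ_iff.mp (Finset.mem_range.mp hk))
    have hc' : ((A.card.choose k : ℝ) * k.factorial * (A.card - k).factorial : ℝ)
        = A.card.factorial := by exact_mod_cast hc
    have h4 : (A.card.factorial : ℝ) ≠ 0 := by positivity
    have h5 : (A.card : ℝ) + 1 ≠ 0 := by positivity
    rw [Nat.factorial_succ, nsmul_eq_mul]
    push_cast
    field_simp
    linear_combination hc'
  rw [Finset.sum_congr rfl hterm, ← Finset.sum_div, neg_one_geom_sum]
  congr 1
  rcases Nat.even_or_odd (A.card + 1) with h | h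
  · simp [h, Nat.even_iff.mp h]
  · simp [Nat.not_even_iff_odd.mpr h, Nat.odd_iff.mp h]

lemma sum_powerset_weight_mul_prod {α : Type*} [DecidableEq α] (A B : Finset α)
    (hAB : Disjoint A B) :
    ∑ S ∈ (A ∪ B).powerset, ((S.card.factorial * ((A ∪ B).card - S.card).factorial : ℕ) : ℝ)
        / (((A ∪ B).card + 1).factorial : ℝ) * ∏ j ∈ S, (if j ∈ A then (-1 : ℝ) else 1)
      = (((A.card + 1) % 2 : ℕ) : ℝ) / ((A.card : ℝ) + 1) := by
  induction B using Finset.induction_on with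
  | empty =>
    rw [Finset.union_empty, ← sum_powerset_weight_mul_neg_one_pow]
    refine Finset.sum_congr rfl fun S hS => ?_
    rw [Finset.prod_congr rfl fun j hj => if_pos (Finset.mem_powerset.mp hS hj),
      Finset.prod_const]
  | insert b B hb ih =>
    rw [Finset.disjoint_insert_right] at hAB
    have hbU : b ∉ A ∪ B := by simp [hAB.1, hb]
    rw [← ih hAB.2, Finset.union_insert, Finset.sum_powerset_insert hbU,
      ← Finset.sum_add_distrib]
    refine Finset.sum_congr rfl fun S hS => ?_
    have hSU := Finset.mem_powerset.mp hS
    have hbS : b ∉ S := fun h => hbU (hSU h)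
    rw [Finset.prod_insert hbS, if_neg hAB.1, one_mul, Finset.card_insert_of_notMem hbU,
      Finset.card_insert_of_notMem hbS, ← add_mul,
      factorial_weight_add (Finset.card_le_card hSU)]

/-- Each coordinate of `S` on which `f` is active and the two points differ flips the parity. -/
lemma neg_one_pow_ip_hybrid {n : ℕ} (f x xstar : Fin n → Fin 2) (S : Finset (Fin n)) :
    (-1 : ℝ) ^ ip f (hybrid xstar x S)
      = (-1 : ℝ) ^ ip f x * ∏ j ∈ S, (if f j = 1 ∧ x j ≠ xstar j then (-1 : ℝ) else 1) := by
  have hS : ∏ j ∈ S, (if f j = 1 ∧ x j ≠ xstar j then (-1 : ℝ) else 1)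
      = ∏ j, if j ∈ S then (if f j = 1 ∧ x j ≠ xstar j then (-1 : ℝ) else 1) else 1 := by
    rw [Finset.prod_ite_mem, Finset.univ_inter]
  rw [hS, ip, ip, ← Finset.prod_pow_eq_pow_sum, ← Finset.prod_pow_eq_pow_sum,
    ← Finset.prod_mul_distrib]
  refine Finset.prod_congr rfl fun j _ => ?_
  by_cases hj : j ∈ S
  · simp only [hybrid, hj, if_true]
    generalize f j = a
    generalize x j = b
    generalize xstar j = c
    fin_cases a <;> fin_cases b <;> fin_cases c <;> simp
  · simp [hybrid, hj]

/-- single-background-point form of the paper's Lemma 1. With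
`Δ = {j : f_j = 1 ∧ x_j ≠ x*_j}` and `A = Δ \ {i}`, the coalition sum of
weighted marginal contributions of feature `i` to `Ψ_f` equals
`−2·f_i·1[x_i ≠ x*_i]·(−1)^{⟨f,x⟩}·((|A|+1) mod 2)/(|A|+1)`. -/
theorem coalition_sum_single_point (n : ℕ) (hn : 1 ≤ n) (f x xstar : Fin n → Fin 2)
    (i : Fin n) :
    ∑ S ∈ (Finset.univ.erase i).powerset,
      shapWeight n S *
        ((-1 : ℝ) ^ ip f (hybrid xstar x (insert i S))
          - (-1 : ℝ) ^ ip f (hybrid xstar x S))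
      = -2 * ((f i : ℕ) : ℝ) * (if x i ≠ xstar i then (1 : ℝ) else 0) *
          (-1 : ℝ) ^ ip f x *
          ((((((Finset.univ.filter (fun j => f j = 1 ∧ x j ≠ xstar j)).erase i).card
              + 1) % 2 : ℕ) : ℝ) /
            ((((Finset.univ.filter (fun j => f j = 1 ∧ x j ≠ xstar j)).erase i).card : ℝ)
              + 1)) := by
  set A := (Finset.univ.filter (fun j => f j = 1 ∧ x j ≠ xstar j)).erase i with hA
  have hAsub : A ⊆ Finset.univ.erase i := Finset.erase_subset_erase i (Finset.subset_univ _)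
  have hU : A ∪ (Finset.univ.erase i \ A) = Finset.univ.erase i :=
    Finset.union_sdiff_of_subset hAsub
  have hcard : (Finset.univ.erase i : Finset (Fin n)).card = n - 1 := by simp
  have key := sum_powerset_weight_mul_prod A (Finset.univ.erase i \ A) Finset.disjoint_sdiff
  rw [hU, hcard, Nat.sub_add_cancel hn] at key
  rw [← key, Finset.mul_sum]
  refine Finset.sum_congr rfl fun S hS => ?_
  have hSsub := Finset.mem_powerset.mp hS
  have hiS : i ∉ S := fun h => Finset.notMem_erase i _ (hSsub h)
  have hprod : ∏ j ∈ S, (if f j = 1 ∧ x j ≠ xstar j then (-1 : ℝ) else 1)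
      = ∏ j ∈ S, (if j ∈ A then (-1 : ℝ) else 1) := by
    refine Finset.prod_congr rfl fun j hj => ?_
    have hji : j ≠ i := fun h => hiS (h ▸ hj)
    simp [hA, hji]
  have hflip : (if f i = 1 ∧ x i ≠ xstar i then (-1 : ℝ) else 1) - 1
      = -2 * ((f i : ℕ) : ℝ) * (if x i ≠ xstar i then (1 : ℝ) else 0) := by
    generalize f i = a
    fin_cases a <;> by_cases hx : x i = xstar i <;> norm_num [hx]
  rw [neg_one_pow_ip_hybrid, neg_one_pow_ip_hybrid, Finset.prod_insert hiS, hprod, ← hflip,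
    shapWeight, Nat.sub_right_comm]
  ring
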